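/- Let α ∈ (0,1), R > 0, and let f : [0,∞) → ℝ be continuous with f ≥ 0, f not identically zero, and supp f ⊂ (0,R). Define w₂(x,t) = ∫₀^∞ (ℰ(x−y,t) + ℰ(x+y,t)) f(y) dy. Then the speed of signal propagation is infinite: w₂(x,t) > 0 for every x ≥ 0 and every t > 0. -/

import Mathlib

open MeasureTheory Real Set
/-- The function `Φ(x) = Σ (−1)ⁿ bₙ (x^{1+α}/(1+α))ⁿ`, where
`bₙ = ∏_{i<n} Γ(αi+i+2)/Γ(α(i+1)+i+2)`; it equals the generalized Mittag-Leffler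
function `E_{α,1+1/α,1/α}(−x^{1+α}/(1+α))`. -/
noncomputable def PhiF (α : ℝ) (x : ℝ) : ℝ :=
  ∑' n : ℕ, (-1:ℝ)^n *
    (∏ i ∈ Finset.range n, Real.Gamma (α * i + i + 2) / Real.Gamma (α * (i+1) + i + 2)) *
    (x ^ (1+α) / (1+α)) ^ n
/-- The normalizing constant `a₀ = (2∫₀^∞ Φ)⁻¹`. -/
noncomputable def a0 (α : ℝ) : ℝ := (2 * ∫ x in Set.Ioi (0:ℝ), PhiF α x)⁻¹

/-- The fundamental solution `ℰ(x,t) = a₀ t^{−1/(1+α)} Φ(|x| t^{−1/(1+α)})` for `t > 0`,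
extended by `0` for `t ≤ 0`. -/
noncomputable def fundSol (α : ℝ) (x t : ℝ) : ℝ :=
  if 0 < t then a0 α * t ^ (-(1/(1+α))) * PhiF α (|x| * t ^ (-(1/(1+α)))) else 0

open Filter Topology ProbabilityTheory

/-- The beta integral rescaled to the interval `(0, x)`. -/
lemma integral_rpow_mul_sub_rpow {u v x : ℝ} (hu : 0 < u) (hv : 0 < v) (hx : 0 < x) :
    ∫ y in (0:ℝ)..x, y ^ (u - 1) * (x - y) ^ (v - 1) = x ^ (u + v - 1) * beta u v := by
  have h := Complex.betaIntegral_scaled (u : ℂ) (v : ℂ) hx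
  have hb : Complex.betaIntegral u v = ((beta u v : ℝ) : ℂ) := by
    rw [Complex.betaIntegral_eq_Gamma_mul_div _ _ (by simpa using hu) (by simpa using hv), beta]
    rw [← Complex.ofReal_add, Complex.Gamma_ofReal, Complex.Gamma_ofReal, Complex.Gamma_ofReal]
    push_cast
    rfl
  rw [hb] at h
  have hl : ∫ y in (0:ℝ)..x, (y:ℂ) ^ ((u:ℂ) - 1) * ((x:ℂ) - y) ^ ((v:ℂ) - 1)
      = ∫ y in (0:ℝ)..x, ((y ^ (u - 1) * (x - y) ^ (v - 1) : ℝ) : ℂ) := by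
    refine intervalIntegral.integral_congr fun y hy => ?_
    rw [uIcc_of_le hx.le] at hy
    rw [Complex.ofReal_mul, Complex.ofReal_cpow hy.1, Complex.ofReal_cpow (sub_nonneg.2 hy.2)]
    push_cast
    rfl
  rw [hl, intervalIntegral.integral_ofReal] at h
  have hr : (x:ℂ) ^ ((u:ℂ) + v - 1) = ((x ^ (u + v - 1) : ℝ) : ℂ) := by
    rw [Complex.ofReal_cpow hx.le]
    push_cast
    rfl
  rw [hr] at h
  exact_mod_cast h

lemma intervalIntegrable_sub_rpow {q : ℝ} (hq : 0 < q) (x : ℝ) :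
    IntervalIntegrable (fun y => (x - y) ^ (q - 1)) volume 0 x := by
  have h := (intervalIntegral.intervalIntegrable_rpow' (a := 0) (b := x)
    (show -1 < q - 1 by linarith)).comp_sub_left x
  simpa using h.symm

lemma norm_mul_deriv_pow_le (c : ℕ → ℝ) (n : ℕ) {y r : ℝ} (hr : 0 < r) (hy : |y| ≤ r) :
    ‖c n * (n * y ^ (n - 1))‖ ≤ |c n * (2 * r) ^ n| / r := by
  rcases n with _ | n
  · simpa using by positivity
  · have h2 : ((n + 1 : ℕ) : ℝ) ≤ 2 ^ (n + 1) := by exact_mod_cast Nat.lt_two_pow_self.le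
    have e : |c (n + 1) * (2 * r) ^ (n + 1)| / r = |c (n + 1)| * (2 ^ (n + 1) * r ^ n) := by
      rw [abs_mul, abs_of_nonneg (by positivity : 0 ≤ (2 * r) ^ (n + 1)), mul_pow, pow_succ r]
      field_simp
    rw [e, norm_mul, norm_mul, norm_pow, Real.norm_eq_abs, Real.norm_eq_abs, Real.norm_eq_abs,
      Nat.abs_cast, Nat.add_sub_cancel]
    gcongr

lemma summable_mul_deriv_pow {c : ℕ → ℝ} (hc : ∀ r : ℝ, Summable fun n => c n * r ^ n) (z : ℝ) :
    Summable fun n : ℕ => c n * (n * z ^ (n - 1)) :=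
  Summable.of_norm_bounded ((hc (2 * (|z| + 1))).abs.div_const (|z| + 1)) fun n =>
    norm_mul_deriv_pow_le c n (by positivity) (lt_add_one _).le

lemma summable_succ_mul_pow {c : ℕ → ℝ} (hc : ∀ r : ℝ, Summable fun n => c n * r ^ n) (z : ℝ) :
    Summable fun n : ℕ => (n + 1) * c (n + 1) * z ^ n := by
  have h := (summable_nat_add_iff 1).2 (summable_mul_deriv_pow hc z)
  simpa [mul_comm, mul_left_comm] using h

/-- An everywhere convergent power series can be differentiated term by term. -/
lemma hasDerivAt_tsum_mul_pow {c : ℕ → ℝ} (hc : ∀ r : ℝ, Summable fun n => c n * r ^ n) (z : ℝ) :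
    HasDerivAt (fun z => ∑' n, c n * z ^ n) (∑' n : ℕ, (n + 1) * c (n + 1) * z ^ n) z := by
  obtain ⟨r, hr⟩ : ∃ r : ℝ, r = |z| + 1 := ⟨_, rfl⟩
  have hz : |z| < r := hr ▸ lt_add_one _
  have hr0 : 0 < r := (abs_nonneg z).trans_lt hz
  have key := hasDerivAt_tsum_of_isPreconnected (𝕜 := ℝ) (F := ℝ)
    (g := fun n z => c n * z ^ n) (t := Ioo (-r) r) (y₀ := 0)
    ((hc (2 * r)).abs.div_const r) isOpen_Ioo isPreconnected_Ioo
    (fun n y _ => (hasDerivAt_pow n y).const_mul _)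
    (fun n y hy => norm_mul_deriv_pow_le c n hr0 (abs_lt.2 hy).le)
    ⟨by linarith, hr0⟩ (hc 0) (abs_lt.1 hz)
  have e : ∑' n : ℕ, (n + 1) * c (n + 1) * z ^ n = ∑' n : ℕ, c n * (n * z ^ (n - 1)) := by
    rw [(summable_mul_deriv_pow hc z).tsum_eq_zero_add]
    simp [mul_comm, mul_left_comm]
  rw [e]
  exact key

lemma continuous_tsum_mul_pow {c : ℕ → ℝ} (hc : ∀ r : ℝ, Summable fun n => c n * r ^ n) :
    Continuous fun z => ∑' n, c n * z ^ n :=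
  continuous_iff_continuousAt.2 fun z => (hasDerivAt_tsum_mul_pow hc z).continuousAt

/-- Term by term fractional integration of an everywhere convergent power series in
`y ^ m / m`, against the weight `y ^ p`. -/
lemma hasSum_fracIntegral {a : ℕ → ℝ} (ha : ∀ r : ℝ, Summable fun n => a n * r ^ n)
    {m p q x : ℝ} (hm : 0 < m) (hp : 0 ≤ p) (hq : 0 < q) (hx : 0 < x) :
    HasSum (fun n : ℕ => a n / m ^ n * (x ^ (m * n + p + q) * beta (m * n + p + 1) q))
      (∫ y in (0:ℝ)..x, (∑' n, a n * (y ^ m / m) ^ n) * (y ^ p * (x - y) ^ (q - 1))) := by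
  have key := intervalIntegral.hasSum_integral_of_dominated_convergence
    (a := 0) (b := x) (μ := volume)
    (F := fun n y => a n * (y ^ m / m) ^ n * (y ^ p * (x - y) ^ (q - 1)))
    (f := fun y => (∑' n, a n * (y ^ m / m) ^ n) * (y ^ p * (x - y) ^ (q - 1)))
    (fun n y => |a n * (x ^ m / m) ^ n| * (x ^ p * (x - y) ^ (q - 1)))
    (fun n => (by fun_prop : Measurable _).aestronglyMeasurable) ?_ ?_ ?_ ?_
  · have e : (fun n : ℕ => a n / m ^ n * (x ^ (m * n + p + q) * beta (m * n + p + 1) q)) =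
        fun n => ∫ y in (0:ℝ)..x, a n * (y ^ m / m) ^ n * (y ^ p * (x - y) ^ (q - 1)) := by
      funext n
      have hu : 0 < m * n + p + 1 := by positivity
      have hb := integral_rpow_mul_sub_rpow hu hq hx
      rw [show m * n + p + 1 + q - 1 = m * n + p + q by ring] at hb
      rw [← hb, ← intervalIntegral.integral_const_mul]
      refine intervalIntegral.integral_congr_ae ?_
      filter_upwards with y hy
      rw [uIoc_of_le hx.le] at hy
      rw [add_sub_cancel_right, rpow_add hy.1, rpow_mul hy.1.le, rpow_natCast, div_pow]
      ring
    rw [e]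
    exact key
  · intro n
    filter_upwards with y hy
    rw [uIoc_of_le hx.le] at hy
    have hxy : 0 ≤ x - y := sub_nonneg.2 hy.2
    have h0 : 0 ≤ y := hy.1.le
    rw [norm_mul, Real.norm_eq_abs, Real.norm_of_nonneg (by positivity), abs_mul, abs_mul,
      abs_of_nonneg (by positivity : 0 ≤ (y ^ m / m) ^ n),
      abs_of_nonneg (by positivity : 0 ≤ (x ^ m / m) ^ n)]
    gcongr
    · exact hy.2
    · exact hy.2
  · filter_upwards with y _
    exact (ha _).abs.mul_right _
  · simp_rw [tsum_mul_right]
    exact ((intervalIntegrable_sub_rpow hq x).const_mul _).const_mul _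
  · filter_upwards with y _
    exact (ha _).hasSum.mul_right _

/-- Ratios of Gamma functions with a positive shift decay at infinity. -/
lemma tendsto_Gamma_div_Gamma_add {α : ℝ} (hα : α ∈ Ioo (0:ℝ) 1) :
    Tendsto (fun s => Gamma s / Gamma (s + α)) atTop (𝓝 0) := by
  obtain ⟨h0, h1⟩ := hα
  have hlim : Tendsto (fun s : ℝ => 2 ^ (1 - α) * s ^ (-α)) atTop (𝓝 0) := by
    simpa using (tendsto_rpow_neg_atTop h0).const_mul (2 ^ (1 - α))
  refine squeeze_zero' ?_ ?_ hlim
  · filter_upwards [eventually_gt_atTop 0] with s hs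
    exact div_nonneg (Gamma_nonneg_of_nonneg hs.le) (Gamma_nonneg_of_nonneg (by linarith))
  · filter_upwards [eventually_ge_atTop 1] with s hs
    have hs0 : 0 < s := by linarith
    have hsα : 0 < s + α := by linarith
    have hG : 0 < Gamma (s + α) := Gamma_pos_of_pos hsα
    have h := Gamma_mul_add_mul_le_rpow_Gamma_mul_rpow_Gamma hsα (by linarith : 0 < s + α + 1)
      h0 (sub_pos.2 h1) (by ring)
    rw [show α * (s + α) + (1 - α) * (s + α + 1) = s + 1 by ring, Gamma_add_one hs0.ne',
      Gamma_add_one hsα.ne', mul_rpow hsα.le hG.le, mul_left_comm, ← rpow_add hG,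
      add_sub_cancel, rpow_one] at h
    have h2 : (s + α) ^ (1 - α) ≤ (2 * s) ^ (1 - α) :=
      rpow_le_rpow hsα.le (by linarith) (by linarith)
    rw [mul_rpow zero_le_two hs0.le, sub_eq_add_neg 1 α, rpow_add hs0, rpow_one] at h2
    rw [div_le_iff₀ hG, ← mul_le_mul_iff_right₀ hs0]
    rw [sub_eq_add_neg] at h ⊢
    nlinarith [mul_le_mul_of_nonneg_right h2 hG.le]

/-- The signed Taylor coefficients of `PhiF` in the variable `x ^ (1 + α) / (1 + α)`. -/
noncomputable def phiCoeff (α : ℝ) (n : ℕ) : ℝ :=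
  (-1) ^ n * ∏ i ∈ Finset.range n, Gamma (α * i + i + 2) / Gamma (α * (i + 1) + i + 2)

lemma phiCoeff_succ (α : ℝ) (n : ℕ) :
    phiCoeff α (n + 1) =
      -phiCoeff α n * (Gamma (α * n + n + 2) / Gamma (α * (n + 1) + n + 2)) := by
  simp only [phiCoeff, Finset.prod_range_succ, pow_succ]
  ring

lemma PhiF_eq_tsum (α x : ℝ) :
    PhiF α x = ∑' n, phiCoeff α n * (x ^ (1 + α) / (1 + α)) ^ n := rfl

lemma summable_phiCoeff_mul_pow {α : ℝ} (hα : α ∈ Ioo (0:ℝ) 1) (r : ℝ) : Summable fun n => phiCoeff α n * r ^ n := by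
  have h0 := hα.1
  have hlin : Tendsto (fun n : ℕ => (1 + α) * (n : ℝ) + 2) atTop atTop :=
    tendsto_atTop_add_const_right _ _
      (tendsto_natCast_atTop_atTop.const_mul_atTop (by linarith : 0 < 1 + α))
  have hlim := (((tendsto_Gamma_div_Gamma_add hα).comp hlin).abs).mul_const |r|
  simp only [abs_zero, zero_mul] at hlim
  refine summable_of_ratio_norm_eventually_le (r := 1 / 2) (by norm_num) ?_
  filter_upwards [hlim.eventually_le_const (by norm_num : (0:ℝ) < 1 / 2)] with n hn
  simp only [Function.comp_apply] at hn
  rw [phiCoeff_succ, show α * (n:ℝ) + n + 2 = (1 + α) * n + 2 by ring,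
    show α * ((n:ℝ) + 1) + n + 2 = (1 + α) * n + 2 + α by ring, pow_succ]
  simp only [norm_mul, norm_neg, Real.norm_eq_abs]
  nlinarith [mul_le_mul_of_nonneg_left hn (by positivity : 0 ≤ |phiCoeff α n| * |r ^ n|)]

lemma PhiF_zero {α : ℝ} (hα : α ∈ Ioo (0:ℝ) 1) : PhiF α 0 = 1 := by
  have h0 := hα.1
  rw [PhiF_eq_tsum, zero_rpow (by linarith), zero_div, tsum_eq_single 0]
  · simp [phiCoeff]
  · intro n hn
    simp [hn]

lemma continuous_PhiF {α : ℝ} (hα : α ∈ Ioo (0:ℝ) 1) : Continuous (PhiF α) :=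
  (continuous_tsum_mul_pow (summable_phiCoeff_mul_pow hα)).comp
    ((continuous_id.rpow_const fun _ => Or.inr (by linarith [hα.1])).div_const _)

/-- Term by term derivative of `PhiF` on the open half-line. -/
lemma hasDerivAt_PhiF {α : ℝ} (hα : α ∈ Ioo (0:ℝ) 1) {y : ℝ} (hy : 0 < y) :
    HasDerivAt (PhiF α)
      ((∑' n : ℕ, (n + 1) * phiCoeff α (n + 1) * (y ^ (1 + α) / (1 + α)) ^ n) * y ^ α) y := by
  have h0 := hα.1
  have hz : HasDerivAt (fun y => y ^ (1 + α) / (1 + α)) (y ^ α) y := by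
    have h := (hasDerivAt_rpow_const (p := 1 + α) (Or.inl hy.ne')).div_const (1 + α)
    rwa [add_sub_cancel_left, mul_div_cancel_left₀ _ (by linarith)] at h
  exact (hasDerivAt_tsum_mul_pow (summable_phiCoeff_mul_pow hα) _).comp y hz

/-- `PhiF` solves the Caputo equation `D^α Φ = -x Φ / (1 + α)`. -/
lemma integral_deriv_PhiF_mul_rpow {α : ℝ} (hα : α ∈ Ioo (0:ℝ) 1) {x : ℝ} (hx : 0 < x) :
    ∫ y in (0:ℝ)..x, (∑' n : ℕ, (n + 1) * phiCoeff α (n + 1) * (y ^ (1 + α) / (1 + α)) ^ n) *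
      (y ^ α * (x - y) ^ (-α)) = -(Gamma (1 - α) / (1 + α) * x) * PhiF α x := by
  have h0 := hα.1
  have hm : 0 < 1 + α := by linarith
  have h := hasSum_fracIntegral (summable_succ_mul_pow (summable_phiCoeff_mul_pow hα)) hm h0.le
    (sub_pos.2 hα.2) hx
  rw [show 1 - α - 1 = -α by ring] at h
  rw [← h.tsum_eq, PhiF_eq_tsum, ← tsum_mul_left]
  refine tsum_congr fun n => ?_
  have hs : 0 < (1 + α) * n + α + 1 := by positivity
  have hG := Gamma_pos_of_pos hs
  have hG2 : 0 < Gamma ((1 + α) * n + 2) := Gamma_pos_of_pos (by positivity)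
  rw [phiCoeff_succ, beta, show α * (n:ℝ) + n + 2 = (1 + α) * n + 2 by ring,
    show α * ((n:ℝ) + 1) + n + 2 = (1 + α) * n + α + 1 + 1 by ring, Gamma_add_one hs.ne',
    show (1 + α) * (n:ℝ) + α + 1 + (1 - α) = (1 + α) * n + 2 by ring,
    show (1 + α) * (n:ℝ) + α + (1 - α) = (1 + α) * n + 1 by ring, rpow_add hx, rpow_mul hx.le,
    rpow_natCast, rpow_one, div_pow, show (1 + α) * (n:ℝ) + α + 1 = (1 + α) * (n + 1) by ring]
  rw [show (1 + α) * (n:ℝ) + α + 1 = (1 + α) * (n + 1) by ring] at hG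
  field_simp

/-- `PhiF` solves the Volterra equation `Φ = 1 - I^α (x Φ) / (1 + α)`. -/
lemma integral_PhiF_mul_rpow {α : ℝ} (hα : α ∈ Ioo (0:ℝ) 1) {x : ℝ} (hx : 0 < x) :
    ∫ y in (0:ℝ)..x, PhiF α y * (y * (x - y) ^ (α - 1)) =
      Gamma α * (1 + α) * (1 - PhiF α x) := by
  have h0 := hα.1
  have hm : 0 < 1 + α := by linarith
  have hc := summable_phiCoeff_mul_pow hα
  have h := hasSum_fracIntegral hc hm zero_le_one h0 hx
  simp only [rpow_one, ← PhiF_eq_tsum] at h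
  have hΦ : PhiF α x = 1 + ∑' n, phiCoeff α (n + 1) * (x ^ (1 + α) / (1 + α)) ^ (n + 1) := by
    rw [PhiF_eq_tsum, (hc _).tsum_eq_zero_add]
    simp [phiCoeff]
  rw [← h.tsum_eq, hΦ, sub_add_cancel_left, mul_neg, ← neg_mul, ← tsum_mul_left]
  refine tsum_congr fun n => ?_
  have hG2 : 0 < Gamma ((1 + α) * n + 2 + α) := Gamma_pos_of_pos (by positivity)
  rw [phiCoeff_succ, beta, show α * (n:ℝ) + n + 2 = (1 + α) * n + 2 by ring,
    show α * ((n:ℝ) + 1) + n + 2 = (1 + α) * n + 2 + α by ring,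
    show (1 + α) * (n:ℝ) + 1 + 1 = (1 + α) * n + 2 by ring,
    show (1 + α) * (n:ℝ) + 1 + α = (1 + α) * (n + 1 : ℕ) by push_cast; ring, rpow_mul hx.le,
    rpow_natCast, div_pow]
  field_simp
  ring

/-- `PhiF` is positive on `[0, ∞)`: a first zero would violate the sign of the Caputo derivative
at a minimum. -/
lemma PhiF_pos {α : ℝ} (hα : α ∈ Ioo (0:ℝ) 1) {x : ℝ} (hx : 0 ≤ x) : 0 < PhiF α x := by
  obtain ⟨h0, h1⟩ := id hα
  have hcont := continuous_PhiF hα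
  by_contra! hneg
  obtain ⟨z, hz, hmin⟩ : ∃ z, (0 ≤ z ∧ PhiF α z ≤ 0) ∧ ∀ y, 0 ≤ y → PhiF α y ≤ 0 → z ≤ y := by
    have hclosed : IsClosed {y | 0 ≤ y ∧ PhiF α y ≤ 0} :=
      isClosed_Ici.inter (isClosed_le hcont continuous_const)
    have hbdd : BddBelow {y | 0 ≤ y ∧ PhiF α y ≤ 0} := ⟨0, fun y hy => hy.1⟩
    exact ⟨_, hclosed.csInf_mem ⟨x, hx, hneg⟩ hbdd, fun y h h' => csInf_le hbdd ⟨h, h'⟩⟩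
  have hz0 : 0 < z := by
    refine hz.1.lt_of_ne fun h => ?_
    have := hz.2
    rw [← h, PhiF_zero hα] at this
    linarith
  have hpos : ∀ y ∈ Ico 0 z, 0 < PhiF α y := fun y hy => by
    by_contra! h
    exact (hmin y hy.1 h).not_gt hy.2
  have hΦz : PhiF α z = 0 := by
    refine le_antisymm hz.2 (ge_of_tendsto (hcont.continuousWithinAt (s := Iio z)) ?_)
    filter_upwards [Ioo_mem_nhdsLT hz0] with y hy
    exact (hpos y ⟨hy.1.le, hy.2⟩).le
  have hdz : DifferentiableAt ℝ (PhiF α) z := (hasDerivAt_PhiF hα hz0).differentiableAt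
  have hFcont : ContinuousOn (fun y => PhiF α y * (z - y) ^ (-α)) (Icc 0 z) := by
    have hds : ContinuousOn (dslope (PhiF α) z) univ :=
      (continuousOn_dslope univ_mem).2 ⟨hcont.continuousOn, hdz⟩
    have hc : ContinuousOn (fun y => -dslope (PhiF α) z y * (z - y) ^ (1 - α)) (Icc 0 z) :=
      (hds.mono (subset_univ _)).neg.mul
        ((continuous_const.sub continuous_id).rpow_const
          fun _ => Or.inr (by linarith)).continuousOn
    refine hc.congr fun y hy => ?_
    have hs := sub_smul_dslope (PhiF α) z y
    rw [hΦz, sub_zero, smul_eq_mul] at hs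
    rcases hy.2.eq_or_lt with rfl | hlt
    · simp [hΦz, zero_rpow (by linarith : 1 - α ≠ 0)]
    · simp only
      rw [← hs, sub_eq_add_neg 1 α, rpow_add (sub_pos.2 hlt), rpow_one]
      ring
  have hint : IntegrableOn (fun y =>
      (∑' n : ℕ, (n + 1) * phiCoeff α (n + 1) * (y ^ (1 + α) / (1 + α)) ^ n) *
        (y ^ α * (z - y) ^ (-α))) (Icc 0 z) := by
    rw [integrableOn_Icc_iff_integrableOn_Ioc, ← intervalIntegrable_iff_integrableOn_Ioc_of_le
      hz0.le]
    have h := intervalIntegrable_sub_rpow (sub_pos.2 h1) z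
    rw [show 1 - α - 1 = -α by ring] at h
    have hc : Continuous fun y : ℝ =>
        ∑' n : ℕ, (n + 1) * phiCoeff α (n + 1) * (y ^ (1 + α) / (1 + α)) ^ n :=
      (continuous_tsum_mul_pow (summable_succ_mul_pow (summable_phiCoeff_mul_pow hα))).comp
        ((continuous_id.rpow_const fun _ => Or.inr (by linarith)).div_const _)
    exact (h.continuousOn_mul
      (continuous_id.rpow_const fun _ => Or.inr h0.le).continuousOn).continuousOn_mul
        hc.continuousOn
  have hderiv : ∀ y ∈ Ioo 0 z, HasDerivAt (fun y => PhiF α y * (z - y) ^ (-α))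
      ((∑' n : ℕ, (n + 1) * phiCoeff α (n + 1) * (y ^ (1 + α) / (1 + α)) ^ n) * y ^ α *
        (z - y) ^ (-α) + PhiF α y * (-1 * -α * (z - y) ^ (-α - 1))) y := fun y hy =>
    (hasDerivAt_PhiF hα hy.1).mul
      (((hasDerivAt_id y).const_sub z).rpow_const (Or.inl (sub_pos.2 hy.2).ne'))
  have key := intervalIntegral.integral_le_sub_of_hasDeriv_right_of_le hz0.le hFcont
    (fun y hy => (hderiv y hy).hasDerivWithinAt) hint fun y hy => by
      have hp := hpos y ⟨hy.1.le, hy.2⟩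
      have hzy : 0 < z - y := sub_pos.2 hy.2
      have : 0 ≤ PhiF α y * (-1 * -α * (z - y) ^ (-α - 1)) := by
        rw [neg_one_mul, neg_neg]
        positivity
      linarith
  rw [integral_deriv_PhiF_mul_rpow hα hz0, hΦz, PhiF_zero hα, sub_zero] at key
  have : 0 < z ^ (-α) := by positivity
  linarith

/-- The Volterra equation bounds the mass of `PhiF` on dyadic intervals. -/
lemma integral_PhiF_le {α : ℝ} (hα : α ∈ Ioo (0:ℝ) 1) {r : ℝ} (hr : 0 < r) :
    ∫ y in r..2 * r, PhiF α y ≤ 2 ^ (1 - α) * (Gamma α * (1 + α)) * r ^ (-α) := by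
  obtain ⟨h0, h1⟩ := id hα
  have hcont := continuous_PhiF hα
  have h2r : 0 < 2 * r := by positivity
  have hi : IntervalIntegrable (fun y => PhiF α y * (y * (2 * r - y) ^ (α - 1))) volume 0
      (2 * r) :=
    ((intervalIntegrable_sub_rpow h0 (2 * r)).continuousOn_mul
      continuous_id.continuousOn).continuousOn_mul hcont.continuousOn
  have hG := Gamma_pos_of_pos h0
  have hle : r * (2 * r) ^ (α - 1) * ∫ y in r..2 * r, PhiF α y ≤ Gamma α * (1 + α) := by
    calc r * (2 * r) ^ (α - 1) * ∫ y in r..2 * r, PhiF α y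
        = ∫ y in r..2 * r, r * (2 * r) ^ (α - 1) * PhiF α y :=
          (intervalIntegral.integral_const_mul _ _).symm
      _ ≤ ∫ y in r..2 * r, PhiF α y * (y * (2 * r - y) ^ (α - 1)) := by
          refine intervalIntegral.integral_mono_on_of_le_Ioo (by linarith)
            ((hcont.intervalIntegrable _ _).const_mul _) (hi.mono_set ?_) fun y hy => ?_
          · rw [uIcc_of_le (by linarith), uIcc_of_le h2r.le]
            exact Icc_subset_Icc_left hr.le
          · have hy0 : 0 < y := hr.trans hy.1
            rw [mul_comm]
            refine mul_le_mul_of_nonneg_left ?_ (PhiF_pos hα hy0.le).le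
            exact mul_le_mul hy.1.le
              (rpow_le_rpow_of_nonpos (sub_pos.2 hy.2) (by linarith) (by linarith))
              (by positivity) hy0.le
      _ ≤ ∫ y in (0:ℝ)..2 * r, PhiF α y * (y * (2 * r - y) ^ (α - 1)) := by
          refine intervalIntegral.integral_mono_interval hr.le (by linarith) le_rfl ?_ hi
          filter_upwards [self_mem_ae_restrict measurableSet_Ioc] with y hy
          have := PhiF_pos hα hy.1.le
          have := hy.1
          have := sub_nonneg.2 hy.2
          simp only [Pi.zero_apply]
          positivity
      _ = Gamma α * (1 + α) * (1 - PhiF α (2 * r)) := integral_PhiF_mul_rpow hα h2r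
      _ ≤ Gamma α * (1 + α) := by
          have := PhiF_pos hα h2r.le
          exact mul_le_of_le_one_right (by positivity) (by linarith)
  have e : 2 ^ (1 - α) * r ^ (-α) * (r * (2 * r) ^ (α - 1)) = 1 := by
    rw [mul_rpow zero_le_two hr.le, show 1 - α = -(α - 1) by ring, rpow_neg zero_le_two,
      rpow_neg hr.le, rpow_sub_one hr.ne']
    field_simp
  calc ∫ y in r..2 * r, PhiF α y
      = 2 ^ (1 - α) * r ^ (-α) * (r * (2 * r) ^ (α - 1) * ∫ y in r..2 * r, PhiF α y) := by
        rw [← mul_assoc, e, one_mul]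
    _ ≤ 2 ^ (1 - α) * r ^ (-α) * (Gamma α * (1 + α)) := by gcongr
    _ = _ := by ring

lemma integrableOn_PhiF {α : ℝ} (hα : α ∈ Ioo (0:ℝ) 1) : IntegrableOn (PhiF α) (Ioi 0) := by
  obtain ⟨h0, h1⟩ := id hα
  have hcont := continuous_PhiF hα
  obtain ⟨C, hC⟩ : ∃ C, C = 2 ^ (1 - α) * (Gamma α * (1 + α)) := ⟨_, rfl⟩
  have hC0 : 0 ≤ C := by
    have := Gamma_pos_of_pos h0
    rw [hC]
    positivity
  obtain ⟨q, hq⟩ : ∃ q : ℝ, q = 2 ^ (-α) := ⟨_, rfl⟩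
  have hq0 : 0 < q := hq ▸ by positivity
  have hq1 : q < 1 := hq ▸ rpow_lt_one_of_one_lt_of_neg one_lt_two (by linarith)
  have hsum : ∀ n : ℕ, ∫ y in (1:ℝ)..2 ^ n, PhiF α y ≤ C / (1 - q) * (1 - q ^ n) := by
    intro n
    induction n with
    | zero => simp
    | succ n ih =>
      have h := integral_PhiF_le hα (by positivity : (0:ℝ) < 2 ^ n)
      rw [← hC, ← rpow_natCast, ← rpow_mul zero_le_two, mul_comm (n:ℝ), rpow_mul zero_le_two,
        ← hq, rpow_natCast, rpow_natCast, ← pow_succ'] at h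
      rw [← intervalIntegral.integral_add_adjacent_intervals (hcont.intervalIntegrable _ (2 ^ n))
        (hcont.intervalIntegrable _ _)]
      have e : C / (1 - q) * (1 - q ^ (n + 1)) = C / (1 - q) * (1 - q ^ n) + C * q ^ n := by
        have : 1 - q ≠ 0 := by linarith
        field_simp
        ring
      linarith
  rw [← Ioc_union_Ioi_eq_Ioi zero_le_one]
  refine (hcont.integrableOn_Ioc).union (integrableOn_Ioi_of_intervalIntegral_norm_bounded
    (C / (1 - q)) 1 (fun n : ℕ => hcont.integrableOn_Ioc)
    (tendsto_pow_atTop_atTop_of_one_lt one_lt_two) (.of_forall fun n => ?_))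
  have hn : (1:ℝ) ≤ 2 ^ n := one_le_pow₀ one_le_two
  calc ∫ y in (1:ℝ)..2 ^ n, ‖PhiF α y‖ = ∫ y in (1:ℝ)..2 ^ n, PhiF α y := by
        refine intervalIntegral.integral_congr fun y hy => ?_
        rw [uIcc_of_le hn] at hy
        exact norm_of_nonneg (PhiF_pos hα (zero_le_one.trans hy.1)).le
    _ ≤ C / (1 - q) * (1 - q ^ n) := hsum n
    _ ≤ C / (1 - q) :=
        mul_le_of_le_one_right (div_nonneg hC0 (by linarith)) (by linarith [pow_pos hq0 n])

lemma a0_pos {α : ℝ} (hα : α ∈ Ioo (0:ℝ) 1) : 0 < a0 α := by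
  have h : 0 < ∫ x in Ioi (0:ℝ), PhiF α x := by
    rw [setIntegral_pos_iff_support_of_nonneg_ae _ (integrableOn_PhiF hα)]
    · have : Function.support (PhiF α) ∩ Ioi 0 = Ioi 0 :=
        inter_eq_right.2 fun y hy => (PhiF_pos hα (le_of_lt hy)).ne'
      simp [this]
    · filter_upwards [self_mem_ae_restrict measurableSet_Ioi] with y hy
      exact (PhiF_pos hα (le_of_lt hy)).le
  unfold a0
  positivity

lemma fundSol_pos {α : ℝ} (hα : α ∈ Ioo (0:ℝ) 1) (x : ℝ) {t : ℝ} (ht : 0 < t) :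
    0 < fundSol α x t := by
  have := a0_pos hα
  have := PhiF_pos hα (by positivity : 0 ≤ |x| * t ^ (-(1/(1+α))))
  rw [fundSol, if_pos ht]
  positivity

lemma continuous_fundSol {α : ℝ} (hα : α ∈ Ioo (0:ℝ) 1) (t : ℝ) :
    Continuous fun x => fundSol α x t := by
  unfold fundSol
  have := continuous_PhiF hα
  split_ifs <;> fun_prop

/-- infinite speed of signal propagation. If `f ≥ 0` is continuous,
not identically zero, with support contained in `(0,R)`, then the Neumann
solution `w₂(x,t) = ∫₀^∞ (ℰ(x−y,t) + ℰ(x+y,t)) f(y) dy` is strictly positive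
for every `x ≥ 0` and `t > 0`. -/
theorem infinite_speed_of_propagation
    (α R : ℝ) (hα : α ∈ Set.Ioo (0:ℝ) 1) (hR : 0 < R)
    (f : ℝ → ℝ)
    (hfc : Continuous f)
    (hfnonneg : ∀ x, 0 ≤ f x)
    (hfne : f ≠ 0)
    (hfsupp : Function.support f ⊆ Set.Ioo 0 R)
    (w₂ : ℝ → ℝ → ℝ)
    (hw₂ : ∀ x t, w₂ x t =
      ∫ y in Set.Ioi (0:ℝ), (fundSol α (x - y) t + fundSol α (x + y) t) * f y) :
    ∀ x ≥ (0:ℝ), ∀ t > (0:ℝ), 0 < w₂ x t := by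
  intro x _ t ht
  obtain ⟨z, hz⟩ := Function.ne_iff.1 hfne
  have hpos : ∀ y, 0 < fundSol α (x - y) t + fundSol α (x + y) t := fun y =>
    add_pos (fundSol_pos hα _ ht) (fundSol_pos hα _ ht)
  have hcont := continuous_fundSol hα t
  have hsupp : HasCompactSupport f :=
    HasCompactSupport.intro isCompact_Icc fun y hy => by
      by_contra h
      exact hy (Ioo_subset_Icc_self (hfsupp h))
  rw [hw₂, setIntegral_eq_integral_of_forall_compl_eq_zero fun y hy => ?_]
  · exact Continuous.integral_pos_of_hasCompactSupport_nonneg_nonzero (x := z)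
      (((hcont.comp (continuous_const.sub continuous_id)).add
        (hcont.comp (continuous_const.add continuous_id))).mul hfc)
      hsupp.mul_left (fun y => mul_nonneg (hpos y).le (hfnonneg y))
      (mul_ne_zero (hpos z).ne' hz)
  · have : f y = 0 := by
      by_contra h
      exact hy (hfsupp h).1
    rw [this, mul_zero]
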